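/- arXiv:2203.05751 — 2 statements merged into one kernel-verified Lean document; each statement's English description precedes it below -/
import Mathlib

section
/- Let φ = (φ_G, φ_F) : (𝒞, S) ⟶ (𝒟, T) be a Ψ-morphism of monads for the adjunction Ψ = (G ⊣ F), and let (x, λ_x) be a T-algebra. Then the two morphisms μ_S(Gx) ∘ S φ_G(x) and S G(λ_x) from S(G(Tx)) to S(Gx) are morphisms of S-algebras from the free S-algebra ρ(S)(G(Tx)) to the free S-algebra ρ(S)(Gx), and together with the common section ρ(S)(G(η_T x)) : ρ(S)(Gx) ⟶ ρ(S)(G(Tx)) they form a reflexive pair in 𝒞^S. Consequently, if 𝒞^S has reflexive coequalizers, the coequalizer of this pair exists in 𝒞^S and carries the structure of an S-algebra. -/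
open CategoryTheory

/-- A `Ψ`-morphism of monads `(𝒞, S) ⟶ (𝒟, T)` relative to an adjunction `Ψ = (G ⊣ F)`:
a pair of natural transformations `φG : GT ⟶ SG`, `φF : TF ⟶ FS` compatible with the monad
structures and with the adjunction. -/
structure PsiMorphism {𝒞 𝒟 : Type*} [Category 𝒞] [Category 𝒟]
    (S : Monad 𝒞) (T : Monad 𝒟) (G : 𝒟 ⥤ 𝒞) (F : 𝒞 ⥤ 𝒟) (adj : G ⊣ F) where
  /-- `φG : GT ⟶ SG` -/
  φG : T.toFunctor ⋙ G ⟶ G ⋙ S.toFunctor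
  /-- `φF : TF ⟶ FS` -/
  φF : F ⋙ T.toFunctor ⟶ S.toFunctor ⋙ F
  /-- `μ_S G ∘ S φG ∘ φG T = φG ∘ G μ_T` -/
  φG_assoc : ∀ x : 𝒟, φG.app (T.obj x) ≫ S.map (φG.app x) ≫ S.μ.app (G.obj x)
      = G.map (T.μ.app x) ≫ φG.app x
  /-- `φG ∘ G η_T = η_S G` -/
  φG_unit : ∀ x : 𝒟, G.map (T.η.app x) ≫ φG.app x = S.η.app (G.obj x)
  /-- `F μ_S ∘ φF S ∘ T φF = φF ∘ μ_T F` -/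
  φF_assoc : ∀ y : 𝒞, T.map (φF.app y) ≫ φF.app (S.obj y) ≫ F.map (S.μ.app y)
      = T.μ.app (F.obj y) ≫ φF.app y
  /-- `φF ∘ η_T F = F η_S` -/
  φF_unit : ∀ y : 𝒞, T.η.app (F.obj y) ≫ φF.app y = F.map (S.η.app y)
  /-- Compatibility: for every `f : Gx ⟶ y`, `φF(y)^L ∘ GT(f^R) = Sf ∘ φG(x)`. -/
  compat : ∀ {x : 𝒟} {y : 𝒞} (f : G.obj x ⟶ y),
      G.map (T.map (adj.homEquiv x y f))
          ≫ (adj.homEquiv (T.obj (F.obj y)) (S.obj y)).symm (φF.app y)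
        = φG.app x ≫ S.map f

open CategoryTheory.Limits

namespace CategoryTheory.Monad

variable {C : Type*} [Category C] (S : Monad C)

/-- The morphism of free algebras extending a Kleisli morphism `X ⟶ S Y`. -/
def freeExtend {X Y : C} (f : X ⟶ S.obj Y) : S.free.obj X ⟶ S.free.obj Y where
  f := S.map f ≫ S.μ.app Y
  h := by
    change S.map (S.map f ≫ S.μ.app Y) ≫ S.μ.app Y = S.μ.app X ≫ S.map f ≫ S.μ.app Y
    rw [Functor.map_comp, Category.assoc, S.assoc]
    exact S.μ.naturality_assoc f _

theorem free_map_freeExtend {X Y Z : C} (g : X ⟶ Y) (f : Y ⟶ S.obj Z) :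
    S.free.map g ≫ S.freeExtend f = S.freeExtend (g ≫ f) := by
  ext
  change S.map g ≫ S.map f ≫ S.μ.app Z = S.map (g ≫ f) ≫ S.μ.app Z
  rw [Functor.map_comp, Category.assoc]

theorem freeExtend_unit (X : C) : S.freeExtend (S.η.app X) = 𝟙 (S.free.obj X) := by
  ext
  exact S.right_unit X

end CategoryTheory.Monad

/-- For a `Ψ`-morphism of monads and a `T`-algebra `(x, λx)`, the maps
`μ_S(Gx) ∘ SφG(x)` and `SG(λx)` underlie morphisms of `S`-algebras between the free algebras
`ρ(S)(G(Tx)) ⇉ ρ(S)(Gx)`, and together with the common section `ρ(S)(G(η_T x))` they form a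
reflexive pair in `𝒞^S`; hence if `𝒞^S` has reflexive coequalizers, their coequalizer exists
in `𝒞^S` (and so carries an `S`-algebra structure). -/
theorem stmt4 {𝒞 𝒟 : Type*} [Category 𝒞] [Category 𝒟]
    {S : Monad 𝒞} {T : Monad 𝒟} {G : 𝒟 ⥤ 𝒞} {F : 𝒞 ⥤ 𝒟} {adj : G ⊣ F}
    (P : PsiMorphism S T G F adj) (A : T.Algebra) :
    ∃ (f₁ f₂ : S.free.obj (G.obj (T.obj A.A)) ⟶ S.free.obj (G.obj A.A))
      (s : S.free.obj (G.obj A.A) ⟶ S.free.obj (G.obj (T.obj A.A))),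
      f₁.f = S.map (P.φG.app A.A) ≫ S.μ.app (G.obj A.A) ∧
      f₂.f = S.map (G.map A.a) ∧
      s = S.free.map (G.map (T.η.app A.A)) ∧
      s ≫ f₁ = 𝟙 (S.free.obj (G.obj A.A)) ∧
      s ≫ f₂ = 𝟙 (S.free.obj (G.obj A.A)) ∧
      (HasReflexiveCoequalizers S.Algebra → HasCoequalizer f₁ f₂) := by
  let s := S.free.map (G.map (T.η.app A.A))
  let f₁ := S.freeExtend (P.φG.app A.A)
  let f₂ := S.free.map (G.map A.a)
  have h₁ : s ≫ f₁ = 𝟙 (S.free.obj (G.obj A.A)) :=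
    (S.free_map_freeExtend _ _).trans
      ((congrArg S.freeExtend (P.φG_unit A.A)).trans (S.freeExtend_unit _))
  have h₂ : s ≫ f₂ = 𝟙 (S.free.obj (G.obj A.A)) := by
    rw [← Functor.map_comp, ← Functor.map_comp, A.unit]
    exact (congrArg S.free.map (G.map_id A.A)).trans (S.free.map_id _)
  refine ⟨f₁, f₂, s, rfl, rfl, rfl, h₁, h₂, fun _ => ?_⟩
  have : IsReflexivePair f₁ f₂ := ⟨s, h₁, h₂⟩
  infer_instance
end

section
/- Let φ = (φ_G, φ_F) : (𝒞, S) ⟶ (𝒟, T) be a Ψ-morphism of monads for the adjunction Ψ = (G ⊣ F). Let (x, λ_x) be a T-algebra, (y, λ_y) an S-algebra, and let β : x ⟶ F y be a morphism of T-algebras, where F y carries the T-algebra structure F λ_y ∘ φ_F(y). Then λ_y ∘ S(β^L) ∘ μ_S(Gx) ∘ S φ_G(x) = λ_y ∘ S(β^L) ∘ S G(λ_x) as morphisms S(G(Tx)) ⟶ y, where β^L : G x ⟶ y is the adjoint transpose of β under G ⊣ F. -/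
open CategoryTheory

/-- The adjoint transpose of a morphism of `T`-algebras `x ⟶ Fy` intertwines the structure map
`G λx` with `λy` along `φG`. -/
theorem PsiMorphism.φG_app_comp_map_homEquiv_symm {𝒞 𝒟 : Type*} [Category 𝒞] [Category 𝒟]
    {S : Monad 𝒞} {T : Monad 𝒟} {G : 𝒟 ⥤ 𝒞} {F : 𝒞 ⥤ 𝒟} {adj : G ⊣ F}
    (P : PsiMorphism S T G F adj) {x : 𝒟} (lx : T.obj x ⟶ x) {y : 𝒞} (ly : S.obj y ⟶ y)
    (β : x ⟶ F.obj y) (hβ : T.map β ≫ P.φF.app y ≫ F.map ly = lx ≫ β) :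
    P.φG.app x ≫ S.map ((adj.homEquiv x y).symm β) ≫ ly
      = G.map lx ≫ (adj.homEquiv x y).symm β := by
  have h := P.compat ((adj.homEquiv x y).symm β)
  rw [Equiv.apply_symm_apply] at h
  calc P.φG.app x ≫ S.map ((adj.homEquiv x y).symm β) ≫ ly
      = (P.φG.app x ≫ S.map ((adj.homEquiv x y).symm β)) ≫ ly := (Category.assoc _ _ _).symm
    _ = G.map (T.map β) ≫
          (adj.homEquiv (T.obj (F.obj y)) (S.obj y)).symm (P.φF.app y) ≫ ly := by
        rw [← h, Category.assoc]
    _ = (adj.homEquiv (T.obj x) y).symm (T.map β ≫ P.φF.app y ≫ F.map ly) := by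
        rw [Adjunction.homEquiv_naturality_left_symm]
        exact congrArg (G.map (T.map β) ≫ ·)
          (adj.homEquiv_naturality_right_symm (P.φF.app y) ly).symm
    _ = G.map lx ≫ (adj.homEquiv x y).symm β := by
        rw [hβ, Adjunction.homEquiv_naturality_left_symm]

/-- **Statement 6.** For a `Ψ`-morphism of monads, a `T`-algebra `(x, λx)`, an `S`-algebra
`(y, λy)`, and a morphism of `T`-algebras `β : x ⟶ Fy` (where `Fy` has structure map
`Fλy ∘ φF(y)`), we have `λy ∘ S(β^L) ∘ μ_S(Gx) ∘ SφG(x) = λy ∘ S(β^L) ∘ SG(λx)`. -/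
theorem stmt6 {𝒞 𝒟 : Type*} [Category 𝒞] [Category 𝒟]
    {S : Monad 𝒞} {T : Monad 𝒟} {G : 𝒟 ⥤ 𝒞} {F : 𝒞 ⥤ 𝒟} {adj : G ⊣ F}
    (P : PsiMorphism S T G F adj)
    (x : 𝒟) (lx : T.obj x ⟶ x)
    (hx_assoc : T.μ.app x ≫ lx = T.map lx ≫ lx) (hx_unit : T.η.app x ≫ lx = 𝟙 x)
    (y : 𝒞) (ly : S.obj y ⟶ y)
    (hy_assoc : S.μ.app y ≫ ly = S.map ly ≫ ly) (hy_unit : S.η.app y ≫ ly = 𝟙 y)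
    (β : x ⟶ F.obj y)
    (hβ : T.map β ≫ (P.φF.app y ≫ F.map ly) = lx ≫ β) :
    S.map (P.φG.app x) ≫ S.μ.app (G.obj x)
        ≫ S.map ((adj.homEquiv x y).symm β) ≫ ly
      = S.map (G.map lx) ≫ S.map ((adj.homEquiv x y).symm β) ≫ ly := by
  have h := P.φG_app_comp_map_homEquiv_symm lx ly β hβ
  have hμ := S.μ.naturality_assoc ((adj.homEquiv x y).symm β) ly
  dsimp only [Functor.comp_map, Functor.comp_obj] at hμ h
  rw [← hμ, hy_assoc]
  simp only [← Functor.map_comp_assoc]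
  exact congrArg (fun f => S.map f ≫ ly) h
end
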